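/- arXiv:2201.13033 — 2 statements merged into one kernel-verified Lean document; each statement's English description precedes it below -/
import Mathlib

section
/- Let h : ℝ → ℝ be twice differentiable on [0, ∞) and let λ₁, λ₂ > 0. Suppose h''(t) + (λ₁ + λ₂)·h'(t) + λ₁·λ₂·h(t) ≥ 0 for all t ≥ 0, and suppose the initial conditions h(0) ≥ 0 and h'(0) + λ₂·h(0) ≥ 0 hold. Then h(t) ≥ 0 for all t ≥ 0. -/
/-- A function on `[a, ∞)` with `g' + c * g ≥ 0` and `g a ≥ 0` is nonnegative. -/
theorem nonneg_of_hasDerivWithinAt_add_mul_nonneg {g g' : ℝ → ℝ} {a c : ℝ}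
    (hg : ∀ t ∈ Set.Ici a, HasDerivWithinAt g (g' t) (Set.Ici a) t)
    (hineq : ∀ t ∈ Set.Ici a, 0 ≤ g' t + c * g t) (ha : 0 ≤ g a) :
    ∀ t ∈ Set.Ici a, 0 ≤ g t := by
  have hderiv : ∀ t ∈ Set.Ici a, HasDerivWithinAt (fun s ↦ Real.exp (c * s) * g s)
      (Real.exp (c * t) * (g' t + c * g t)) (Set.Ici a) t := fun t ht ↦ by
    have hexp : HasDerivAt (fun s ↦ Real.exp (c * s)) (Real.exp (c * t) * c) t := by
      simpa using ((hasDerivAt_id t).const_mul c).exp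
    exact (hexp.hasDerivWithinAt.mul (hg t ht)).congr_deriv (by ring)
  have hmono : MonotoneOn (fun s ↦ Real.exp (c * s) * g s) (Set.Ici a) :=
    monotoneOn_of_hasDerivWithinAt_nonneg (convex_Ici a)
      (fun t ht ↦ (hderiv t ht).continuousWithinAt)
      (fun t ht ↦ (hderiv t (interior_subset ht)).mono interior_subset)
      (fun t ht ↦ mul_nonneg (Real.exp_pos _).le (hineq t (interior_subset ht)))
  intro t ht
  exact nonneg_of_mul_nonneg_right
    ((mul_nonneg (Real.exp_pos _).le ha).trans (hmono Set.self_mem_Ici ht ht))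
    (Real.exp_pos _)

/-- Relative-degree-2 Exponential Control Barrier Function invariance:
if `h` is twice differentiable on `[0, ∞)`, `λ₁, λ₂ > 0`,
`h'' t + (λ₁ + λ₂) * h' t + λ₁ * λ₂ * h t ≥ 0` for all `t ≥ 0`,
`h 0 ≥ 0` and `h' 0 + λ₂ * h 0 ≥ 0`, then `h t ≥ 0` for all `t ≥ 0`. -/
theorem ecbf_degree_two (h h' h'' : ℝ → ℝ) (lam₁ lam₂ : ℝ)
    (hlam₁ : 0 < lam₁) (hlam₂ : 0 < lam₂)
    (hdiff : ∀ t ∈ Set.Ici (0 : ℝ), HasDerivWithinAt h (h' t) (Set.Ici 0) t)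
    (hdiff' : ∀ t ∈ Set.Ici (0 : ℝ), HasDerivWithinAt h' (h'' t) (Set.Ici 0) t)
    (hineq : ∀ t ∈ Set.Ici (0 : ℝ),
      0 ≤ h'' t + (lam₁ + lam₂) * h' t + lam₁ * lam₂ * h t)
    (h0 : 0 ≤ h 0) (h0' : 0 ≤ h' 0 + lam₂ * h 0) :
    ∀ t ∈ Set.Ici (0 : ℝ), 0 ≤ h t := by
  refine nonneg_of_hasDerivWithinAt_add_mul_nonneg (c := lam₂) hdiff ?_ h0
  refine nonneg_of_hasDerivWithinAt_add_mul_nonneg (c := lam₁)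
    (fun t ht ↦ (hdiff' t ht).add ((hdiff t ht).const_mul lam₂)) (fun t ht ↦ ?_) h0'
  have := hineq t ht
  linarith
end

section
/- Let r ≥ 1, let λ₁, …, λᵣ > 0, and let ν₀, ν₁, …, νᵣ : ℝ → ℝ be functions such that for each j ∈ {0, …, r−1}, νⱼ is differentiable on [0, ∞) with νⱼ'(t) = ν_{j+1}(t) − λ_{j+1}·νⱼ(t) for all t ≥ 0. Suppose νᵣ(t) ≥ 0 for all t ≥ 0, and νⱼ(0) ≥ 0 for every j ∈ {0, …, r−1}. Then ν₀(t) ≥ 0 for all t ≥ 0. -/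
/-- If `f' = g - c f` on `[0, ∞)` with `0 ≤ g` and `0 ≤ f 0`, then `f` is nonnegative on `[0, ∞)`:
the function `exp (c t) f t` is monotone there. -/
theorem nonneg_of_hasDerivWithinAt_sub_mul {f g : ℝ → ℝ} {c : ℝ}
    (hf : ∀ t ∈ Set.Ici (0 : ℝ), HasDerivWithinAt f (g t - c * f t) (Set.Ici 0) t)
    (hg : ∀ t ∈ Set.Ici (0 : ℝ), 0 ≤ g t) (h0 : 0 ≤ f 0) :
    ∀ t ∈ Set.Ici (0 : ℝ), 0 ≤ f t := by
  have hderiv : ∀ t ∈ Set.Ici (0 : ℝ),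
      HasDerivWithinAt (fun s => Real.exp (c * s) * f s) (Real.exp (c * t) * g t) (Set.Ici 0) t := by
    intro t ht
    have hexp : HasDerivAt (fun s => Real.exp (c * s)) (Real.exp (c * t) * c) t := by
      simpa using ((hasDerivAt_id t).const_mul c).exp
    exact (hexp.hasDerivWithinAt.mul (hf t ht)).congr_deriv (by ring)
  have hmono : MonotoneOn (fun s => Real.exp (c * s) * f s) (Set.Ici 0) :=
    monotoneOn_of_hasDerivWithinAt_nonneg (convex_Ici 0)
      (fun t ht => (hderiv t ht).continuousWithinAt)
      (fun t ht => (hderiv t (interior_subset ht)).mono interior_subset)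
      (fun t ht => mul_nonneg (Real.exp_pos _).le (hg t (interior_subset ht)))
  intro t ht
  have hle : f 0 ≤ Real.exp (c * t) * f t := by
    simpa using hmono Set.self_mem_Ici ht ht
  exact nonneg_of_mul_nonneg_right (h0.trans hle) (Real.exp_pos _)

/-- General Exponential Control Barrier Function invariance for relative degree `r`,
for a gain corresponding to `r` negative real poles `-λ₁, …, -λᵣ`:
given a cascade `νⱼ' = ν_{j+1} - λ_{j+1} νⱼ` (for `j = 0, …, r-1`) with
`νᵣ t ≥ 0` for all `t ≥ 0` and `νⱼ 0 ≥ 0` for all `j < r`,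
we conclude `ν₀ t ≥ 0` for all `t ≥ 0`. -/
theorem ecbf_general (r : ℕ) (hr : 1 ≤ r) (lam : ℕ → ℝ) (ν : ℕ → ℝ → ℝ)
    (hlam : ∀ j, 1 ≤ j → j ≤ r → 0 < lam j)
    (hdiff : ∀ j < r, ∀ t ∈ Set.Ici (0 : ℝ),
      HasDerivWithinAt (ν j) (ν (j + 1) t - lam (j + 1) * ν j t) (Set.Ici 0) t)
    (hr_nonneg : ∀ t ∈ Set.Ici (0 : ℝ), 0 ≤ ν r t)
    (h0 : ∀ j < r, 0 ≤ ν j 0) :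
    ∀ t ∈ Set.Ici (0 : ℝ), 0 ≤ ν 0 t := by
  exact Nat.decreasingInduction (motive := fun k _ => ∀ t ∈ Set.Ici (0 : ℝ), 0 ≤ ν k t)
    (fun k hk ih => nonneg_of_hasDerivWithinAt_sub_mul (hdiff k hk) ih (h0 k hk))
    hr_nonneg (Nat.zero_le r)
end
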